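/- Control of the full curvature by its symmetric part (smooth compactly supported version of Lemma 3.1): let Ω ⊆ ℝ³ be open. There exists a constant c > 0 such that for every smooth compactly supported map u : ℝ³ → ℝ³ with support contained in Ω, one has ∫_Ω (‖sym ∇u‖² + ‖sym(Curl(sym ∇u))‖²) dx ≥ c · ∫_Ω (‖sym ∇u‖² + ‖Curl(sym ∇u)‖²) dx, where ‖·‖ is the Frobenius norm on 3×3 matrices. -/

import Mathlib

open Matrix MeasureTheory

noncomputable section

abbrev V3 : Type := Fin 3 → ℝ
abbrev M3 : Type := Matrix (Fin 3) (Fin 3) ℝ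

/-- Partial derivative `∂ⱼ f`. -/
def pd (j : Fin 3) (f : V3 → ℝ) (x : V3) : ℝ := fderiv ℝ f x (Pi.single j 1)

/-- Levi-Civita symbol `ε i j k`. -/
def lc (i j k : Fin 3) : ℝ :=
  ((j.val : ℝ) - i.val) * ((k.val : ℝ) - j.val) * ((k.val : ℝ) - i.val) / 2

/-- Gradient (Jacobian) of a vector field: `(∇u)ᵢⱼ = ∂ⱼ uᵢ`. -/
def grad (u : V3 → V3) (x : V3) : M3 := Matrix.of fun i j => pd j (fun y => u y i) x

/-- curl of a vector field: `(curl u)ᵢ = ε i j k ∂ⱼ uₖ`. -/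
def vcurl (u : V3 → V3) (x : V3) : V3 := fun i => ∑ j, ∑ k, lc i j k * pd j (fun y => u y k) x

/-- divergence of a vector field. -/
def vdiv (u : V3 → V3) (x : V3) : ℝ := ∑ i, pd i (fun y => u y i) x

/-- Row-wise Curl of a matrix field: `(Curl P)ᵢⱼ = ε j k l ∂ₖ P i l`. -/
def mCurl (P : V3 → M3) (x : V3) : M3 :=
  Matrix.of fun i j => ∑ k, ∑ l, lc j k l * pd k (fun y => P y i l) x

/-- Row-wise divergence of a matrix field: `(Div P)ᵢ = ∂ⱼ P i j`. -/
def mDiv (P : V3 → M3) (x : V3) : V3 := fun i => ∑ j, pd j (fun y => P y i j) x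

/-- Symmetric part of a matrix. -/
def symM (X : M3) : M3 := (1/2 : ℝ) • (X + Xᵀ)

/-- Skew-symmetric part of a matrix. -/
def skewM (X : M3) : M3 := (1/2 : ℝ) • (X - Xᵀ)

/-- Deviatoric (trace-free) part of a matrix. -/
def devM (X : M3) : M3 := X - (Matrix.trace X / 3) • (1 : M3)

/-- The axial vector of a (skew-symmetric) matrix: `axl Ā = (Ā₃₂, Ā₁₃, Ā₂₁)`. -/
def axl (X : M3) : V3 := ![X 2 1, X 0 2, X 1 0]

/-- `(anti v)ᵢⱼ = -ε i j k vₖ`. -/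
def antiV (v : V3) : M3 := Matrix.of fun i j => -∑ k, lc i j k * v k

/-- Cross product on `ℝ³`. -/
def cross3 (a b : V3) : V3 := fun i => ∑ j, ∑ k, lc i j k * a j * b k

/-- Euclidean inner product on `ℝ³`. -/
def dot3 (a b : V3) : ℝ := ∑ i, a i * b i

/-- Squared Frobenius norm of a matrix. -/
def frob2 (X : M3) : ℝ := ∑ i, ∑ j, (X i j) ^ 2

/-- Smooth compactly supported scalar functions whose closed support lies in `K`. -/
structure IsTest (K : Set V3) (f : V3 → ℝ) : Prop where
  smooth : ContDiff ℝ (⊤ : ℕ∞) f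
  compact : HasCompactSupport f
  supp : tsupport f ⊆ K

namespace IsTest

variable {K : Set V3} {f g : V3 → ℝ}

lemma differentiable (hf : IsTest K f) : Differentiable ℝ f :=
  hf.smooth.differentiable (by simp)

lemma zero : IsTest K (fun _ => 0) :=
  ⟨contDiff_const, HasCompactSupport.zero, by simp [tsupport]⟩

lemma add (hf : IsTest K f) (hg : IsTest K g) : IsTest K (fun x => f x + g x) :=
  ⟨hf.smooth.add hg.smooth, hf.compact.add hg.compact,
    (tsupport_add f g).trans (Set.union_subset hf.supp hg.supp)⟩

lemma mul (hf : IsTest K f) (hg : IsTest K g) : IsTest K (fun x => f x * g x) :=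
  ⟨hf.smooth.mul hg.smooth, hf.compact.mul_right, (tsupport_mul_subset_left).trans hf.supp⟩

lemma const_mul (hf : IsTest K f) (c : ℝ) : IsTest K (fun x => c * f x) :=
  ⟨contDiff_const.mul hf.smooth, hf.compact.mul_left,
    (tsupport_mul_subset_right (f := fun _ => c)).trans hf.supp⟩

lemma sum {ι : Type*} (s : Finset ι) {F : ι → V3 → ℝ} (hF : ∀ i, IsTest K (F i)) :
    IsTest K (fun x => ∑ i ∈ s, F i x) := by
  classical
  induction s using Finset.induction_on with
  | empty => simpa using zero
  | insert a s ha ih => simpa [Finset.sum_insert ha] using (hF a).add ih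

lemma pd (hf : IsTest K f) (j : Fin 3) : IsTest K (pd j f) := by
  refine ⟨?_, hf.compact.fderiv_apply ℝ _, ?_⟩
  · exact (hf.smooth.fderiv_right (m := (⊤ : ℕ∞)) (by simp)).clm_apply contDiff_const
  · exact (tsupport_fderiv_apply_subset ℝ _).trans hf.supp

lemma integrable (hf : IsTest K f) (μ : Measure V3) [IsFiniteMeasureOnCompacts μ] :
    Integrable f μ :=
  hf.smooth.continuous.integrable_of_hasCompactSupport hf.compact

lemma eq_zero (hf : IsTest K f) {x : V3} (hx : x ∉ K) : f x = 0 :=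
  image_eq_zero_of_notMem_tsupport fun h => hx (hf.supp h)

end IsTest

section

variable {K : Set V3} {f g : V3 → ℝ}

lemma pd_add (hf : IsTest K f) (hg : IsTest K g) (j : Fin 3) (x : V3) :
    pd j (fun y => f y + g y) x = pd j f x + pd j g x := by
  simp only [pd]
  rw [fderiv_fun_add (hf.differentiable x) (hg.differentiable x)]
  rfl

lemma pd_const_mul (hf : IsTest K f) (c : ℝ) (j : Fin 3) (x : V3) :
    pd j (fun y => c * f y) x = c * pd j f x := by
  simp only [pd]
  rw [fderiv_const_mul (hf.differentiable x)]
  rfl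

lemma pd_sum {F : Fin 3 → V3 → ℝ} (hF : ∀ i, IsTest K (F i)) (j : Fin 3) (x : V3) :
    pd j (fun y => ∑ i, F i y) x = ∑ i, pd j (F i) x := by
  simp only [pd]
  rw [fderiv_fun_sum fun i _ => (hF i).differentiable x]
  simp

lemma pd_comm (hf : IsTest K f) (i j : Fin 3) (x : V3) :
    pd i (pd j f) x = pd j (pd i f) x := by
  have hd : DifferentiableAt ℝ (fderiv ℝ f) x :=
    (hf.smooth.fderiv_right (m := (⊤ : ℕ∞)) (by simp)).differentiable (by simp) x
  have key (a b : Fin 3) : pd a (pd b f) x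
      = fderiv ℝ (fderiv ℝ f) x (Pi.single a 1) (Pi.single b 1) := by
    change fderiv ℝ (fun y => fderiv ℝ f y (Pi.single b 1)) x (Pi.single a 1) = _
    rw [fderiv_clm_apply hd (differentiableAt_const _)]
    simp
  rw [key, key]
  exact (hf.smooth.contDiffAt.isSymmSndFDerivAt (by simp; exact WithTop.coe_le_coe.2 le_top)).eq _ _

lemma integral_mul_pd (hf : IsTest K f) (hg : IsTest K g) (j : Fin 3) :
    ∫ x, pd j f x * g x = -∫ x, f x * pd j g x := by
  have h := integral_mul_fderiv_eq_neg_fderiv_mul_of_integrable (μ := (volume : Measure V3))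
    (v := Pi.single j 1) (f := f) (g := g) (((hf.pd j).mul hg).integrable _)
    ((hf.mul (hg.pd j)).integrable _) ((hf.mul hg).integrable _) (fun x _ => hf.differentiable x)
    (fun x _ => hg.differentiable x)
  simp only [pd]
  rw [h, neg_neg]

/-- For a divergence-free test field, `∇w` and `(∇w)ᵀ` are `L²`-orthogonal. -/
lemma integral_grad_mul_transpose_eq_zero {w : Fin 3 → V3 → ℝ} (hw : ∀ j, IsTest K (w j))
    (hdiv : ∀ x, ∑ i, pd i (w i) x = 0) :
    ∫ x, ∑ i, ∑ j, pd i (w j) x * pd j (w i) x = 0 := by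
  have hprod (i j : Fin 3) : IsTest K fun x => pd i (w j) x * pd j (w i) x :=
    ((hw j).pd i).mul ((hw i).pd j)
  have hdiv' (j : Fin 3) (x : V3) : ∑ i, pd i (pd j (w i)) x = 0 := by
    simp_rw [fun i => pd_comm (hw i) i j x]
    rw [← pd_sum fun i => (hw i).pd i]
    simp_rw [hdiv]
    simp [pd]
  rw [integral_finsetSum _ fun i _ => (IsTest.sum _ fun j => hprod i j).integrable _]
  simp_rw [fun i => integral_finsetSum Finset.univ fun j _ => (hprod i j).integrable volume,
    fun i j => integral_mul_pd (hw j) ((hw i).pd j) i]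
  rw [Finset.sum_comm]
  refine Finset.sum_eq_zero fun j _ => ?_
  rw [Finset.sum_neg_distrib, ← integral_finsetSum _ fun i _ =>
    ((hw j).mul (((hw i).pd j).pd i)).integrable _]
  simp_rw [← Finset.mul_sum, hdiv']
  simp

lemma isTest_component {Ω : Set V3} {u : V3 → V3} (hu : ContDiff ℝ (⊤ : ℕ∞) u)
    (hc : HasCompactSupport u) (hs : tsupport u ⊆ Ω) (i : Fin 3) :
    IsTest Ω (fun y => u y i) := by
  have hsub : Function.support (fun y => u y i) ⊆ Function.support u := by
    intro y hy h
    exact hy (by simp [h])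
  exact ⟨contDiff_pi.1 hu i, hc.mono hsub, (closure_mono hsub).trans hs⟩

lemma isTest_half_vcurl {u : V3 → V3} (hu : ∀ i, IsTest K (fun y => u y i)) (j : Fin 3) :
    IsTest K (fun y => 1 / 2 * vcurl u y j) :=
  (IsTest.sum _ fun k => IsTest.sum _ fun l => ((hu l).pd k).const_mul (lc j k l)).const_mul _

lemma pd_half_vcurl {u : V3 → V3} (hu : ∀ i, IsTest K (fun y => u y i)) (i j : Fin 3) (x : V3) :
    pd i (fun y => 1 / 2 * vcurl u y j) x
      = 1 / 2 * ∑ k, ∑ l, lc j k l * pd i (pd k (fun y => u y l)) x := by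
  have h1 (k l : Fin 3) : IsTest K (fun y => lc j k l * pd k (fun z => u z l) y) :=
    ((hu l).pd k).const_mul _
  simp only [vcurl]
  rw [pd_const_mul (IsTest.sum _ fun k => IsTest.sum _ fun l => h1 k l),
    pd_sum fun k => IsTest.sum _ fun l => h1 k l]
  simp_rw [fun k => pd_sum (h1 k), fun k l => pd_const_mul ((hu l).pd k) (lc j k l) i x]

lemma div_half_vcurl {u : V3 → V3} (hu : ∀ i, IsTest K (fun y => u y i)) (x : V3) :
    ∑ i, pd i (fun y => 1 / 2 * vcurl u y i) x = 0 := by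
  simp_rw [pd_half_vcurl hu]
  simp only [Fin.sum_univ_three, lc]
  have h (l : Fin 3) := pd_comm (hu l) 0 1 x
  have h' (l : Fin 3) := pd_comm (hu l) 0 2 x
  have h'' (l : Fin 3) := pd_comm (hu l) 1 2 x
  simp only [h, h', h'']
  norm_num
  ring

lemma symM_grad_apply (u : V3 → V3) (x : V3) (i j : Fin 3) :
    symM (grad u x) i j = 1 / 2 * (pd j (fun y => u y i) x + pd i (fun y => u y j) x) := by
  simp [symM, grad]

/-- `Curl (sym ∇u) = (∇ (curl u / 2))ᵀ`. -/
lemma mCurl_symM_grad {u : V3 → V3} (hu : ∀ i, IsTest K (fun y => u y i)) (x : V3)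
    (i j : Fin 3) :
    mCurl (fun y => symM (grad u y)) x i j = pd i (fun y => 1 / 2 * vcurl u y j) x := by
  rw [pd_half_vcurl hu]
  simp only [mCurl, Matrix.of_apply, symM_grad_apply]
  simp_rw [fun k l => pd_const_mul (((hu i).pd l).add ((hu l).pd i)) (1 / 2) k x,
    fun k l => pd_add ((hu i).pd l) ((hu l).pd i) k x, fun k l => pd_comm (hu l) k i x]
  have h := pd_comm (hu i) 0 1 x
  have h' := pd_comm (hu i) 0 2 x
  have h'' := pd_comm (hu i) 1 2 x
  simp only [Fin.sum_univ_three, h, h', h'', lc]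
  fin_cases j <;> norm_num <;> ring

lemma frob2_symM (X : M3) :
    frob2 (symM X) = 1 / 2 * frob2 X + 1 / 2 * ∑ i, ∑ j, X i j * X j i := by
  simp only [frob2, symM, Fin.sum_univ_three, Matrix.smul_apply, Matrix.add_apply,
    Matrix.transpose_apply, smul_eq_mul]
  ring

lemma frob2_nonneg (X : M3) : 0 ≤ frob2 X :=
  Finset.sum_nonneg fun _ _ => Finset.sum_nonneg fun _ _ => sq_nonneg _

lemma isTest_frob2 {P : V3 → M3} (hP : ∀ i j, IsTest K fun x => P x i j) :
    IsTest K fun x => frob2 (P x) := by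
  simp only [frob2, sq]
  exact IsTest.sum _ fun i => IsTest.sum _ fun j => (hP i j).mul (hP i j)

end

/-- Control of the full curvature by its symmetric part. -/
theorem sym_curvature_controls_curvature (Ω : Set V3) (hΩ : IsOpen Ω) :
    ∃ c : ℝ, 0 < c ∧ ∀ u : V3 → V3,
      ContDiff ℝ (⊤ : ℕ∞) u → HasCompactSupport u → tsupport u ⊆ Ω →
      (∫ x in Ω, (frob2 (symM (grad u x))
            + frob2 (symM (mCurl (fun y => symM (grad u y)) x))))
        ≥ c * ∫ x in Ω, (frob2 (symM (grad u x))
            + frob2 (mCurl (fun y => symM (grad u y)) x)) := by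
  refine ⟨1 / 2, by norm_num, fun u hsm hc hs => ?_⟩
  have hu := isTest_component hsm hc hs
  have hw := isTest_half_vcurl hu
  have hS : IsTest Ω fun x => frob2 (symM (grad u x)) := by
    refine isTest_frob2 fun i j => ?_
    simp only [symM_grad_apply]
    exact (((hu i).pd j).add ((hu j).pd i)).const_mul _
  have hX (i j : Fin 3) : IsTest Ω fun x => mCurl (fun y => symM (grad u y)) x i j := by
    simp only [mCurl_symM_grad hu]
    exact (hw j).pd i
  have hC := isTest_frob2 hX
  have hQ : IsTest Ω fun x => ∑ i, ∑ j, mCurl (fun y => symM (grad u y)) x i j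
      * mCurl (fun y => symM (grad u y)) x j i :=
    IsTest.sum _ fun i => IsTest.sum _ fun j => (hX i j).mul (hX j i)
  have hQ0 : ∫ x in Ω, ∑ i, ∑ j, mCurl (fun y => symM (grad u y)) x i j
      * mCurl (fun y => symM (grad u y)) x j i = 0 := by
    rw [setIntegral_eq_integral_of_forall_compl_eq_zero fun x hx => hQ.eq_zero hx]
    simp only [mCurl_symM_grad hu]
    exact integral_grad_mul_transpose_eq_zero hw (div_half_vcurl hu)
  have hS0 : 0 ≤ ∫ x in Ω, frob2 (symM (grad u x)) :=
    integral_nonneg fun x => frob2_nonneg _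
  simp only [frob2_symM (mCurl _ _)]
  rw [integral_add (hS.integrable _) (((hC.const_mul _).add (hQ.const_mul _)).integrable _),
    integral_add ((hC.const_mul _).integrable _) ((hQ.const_mul _).integrable _),
    integral_add (hS.integrable _) (hC.integrable _), integral_const_mul, integral_const_mul, hQ0]
  linarith
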